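/- Assume d is not a square in F. Let χ₁, χ₂ : F^× → ℂ^× be group homomorphisms with finite conductor exponents c(χ₁), c(χ₂), and let Ω : T(F) → ℂ^× be a group homomorphism with finite conductor exponent c(Ω) such that Ω(z·1) = χ₁(z)·χ₂(z) for all z ∈ F^×. Set r := max{c(Ω), c(χ₁) + c(χ₂)} + 1 + v(a). Then there exists a (necessarily unique) function f̂ : GL₂(F) → ℂ such that f̂(g) = |α/δ|^{1/2}·χ₁(α)·χ₂(δ) whenever g = [[α, β'],[0, δ]]·k with α, δ ∈ F^×, β' ∈ F, k ∈ K₂(p^r) (here |·| is the normalized absolute value with |ϖ| = q^{−1} and |α/δ|^{1/2} its positive square root), and f̂(g) = 0 whenever g ∉ B(F)·K₂(p^r). Moreover, for any such f̂ the function t ↦ f̂(t)·Ω(t)^{−1} on T(F) descends to a locally constant function on the quotient group T(F)/Z_T, this quotient group is compact, and the integral of the descended function against any Haar measure on T(F)/Z_T is nonzero. -/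

import Mathlib

open scoped Pointwise
open Matrix MeasureTheory

noncomputable section

abbrev Zm0 : Type := WithZero (Multiplicative ℤ)

/-- `ev n` is the value (in `ℤₘ₀ = WithZero (Multiplicative ℤ)`) of an element of additive
valuation `n`; thus `x ∈ 𝔭^n` iff `v x ≤ ev n`, `x ∈ 𝔬` iff `v x ≤ ev 0`, and `x ∈ 𝔬^×` iff
`v x = ev 0`. -/
def ev (n : ℤ) : Zm0 := ((Multiplicative.ofAdd (-n) : Multiplicative ℤ) : Zm0)

variable {F : Type*} [Field F]

/-- the matrix M = [[0, c],[−a, −b]] -/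
def Mmat (a b c : F) : Matrix (Fin 2) (Fin 2) F := !![0, c; -a, -b]

lemma Mmat_sq (a b c : F) :
    Mmat a b c * Mmat a b c = (-(a * c)) • (1 : Matrix (Fin 2) (Fin 2) F) + (-b) • Mmat a b c := by
  ext i j
  fin_cases i <;> fin_cases j <;>
    simp [Mmat, Matrix.mul_apply, Fin.sum_univ_two, Matrix.one_apply] <;> ring

/-- the commutative F-subalgebra F·1 + F·M of M₂(F); its unit group is the torus T(F) -/
def Talg (a b c : F) : Subalgebra F (Matrix (Fin 2) (Fin 2) F) where
  carrier := {m | ∃ x y : F, m = x • (1 : Matrix (Fin 2) (Fin 2) F) + y • Mmat a b c}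
  add_mem' := by
    rintro p q ⟨x1, y1, rfl⟩ ⟨x2, y2, rfl⟩
    exact ⟨x1 + x2, y1 + y2, by module⟩
  mul_mem' := by
    rintro p q ⟨x1, y1, rfl⟩ ⟨x2, y2, rfl⟩
    refine ⟨x1 * x2 - a * c * (y1 * y2), x1 * y2 + y1 * x2 - b * (y1 * y2), ?_⟩
    have h := Mmat_sq a b c
    have expand : (x1 • (1 : Matrix (Fin 2) (Fin 2) F) + y1 • Mmat a b c)
        * (x2 • (1 : Matrix (Fin 2) (Fin 2) F) + y2 • Mmat a b c)
        = (x1 * x2) • (1 : Matrix (Fin 2) (Fin 2) F)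
          + (x1 * y2 + y1 * x2) • Mmat a b c + (y1 * y2) • (Mmat a b c * Mmat a b c) := by
      simp only [add_mul, mul_add, smul_mul_assoc, mul_smul_comm, smul_smul, one_mul, mul_one]
      module
    rw [expand, h]
    module
  algebraMap_mem' := fun r => ⟨r, 0, by simp [Algebra.algebraMap_eq_smul_one]⟩

/-- Z_T : the subgroup of nonzero scalars in T(F) = (Talg a b c)ˣ -/
def Zsub (a b c : F) : Subgroup (Talg a b c)ˣ :=
  (Units.map (algebraMap F (Talg a b c)).toMonoidHom).range

instance Zsub_normal (a b c : F) : (Zsub a b c).Normal := by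
  constructor
  intro m hm g
  obtain ⟨z, hz⟩ := hm
  have hcomm : g * m = m * g := by
    apply Units.ext
    rw [Units.val_mul, Units.val_mul, ← hz, Units.coe_map]
    exact (Algebra.commutes (z : F) ((g : (Talg a b c)ˣ) : Talg a b c)).symm
  have h2 : g * m * g⁻¹ = m := by rw [hcomm, mul_inv_cancel_right]
  rw [h2]; exact ⟨z, hz⟩

/-- GL₂(𝔬) : integral entries and unit determinant -/
def GL2O (v : Valuation F Zm0) : Set (Matrix (Fin 2) (Fin 2) F) :=
  {g | (∀ i j, v (g i j) ≤ ev 0) ∧ v g.det = ev 0}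

/-- K₂(𝔭ⁿ) = { g ∈ GL₂(𝔬) : g₁₁ ∈ 1 + 𝔭ⁿ, g₂₂ ∈ 1 + 𝔭ⁿ, g₂₁ ∈ 𝔭ⁿ } -/
def K2 (v : Valuation F Zm0) (n : ℕ) : Set (Matrix (Fin 2) (Fin 2) F) :=
  {g | g ∈ GL2O v ∧ v (g 0 0 - 1) ≤ ev n ∧ v (g 1 1 - 1) ≤ ev n ∧ v (g 1 0) ≤ ev n}

/-- B(F): invertible upper triangular matrices -/
def BF (F : Type*) [Field F] : Set (Matrix (Fin 2) (Fin 2) F) :=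
  {g | g 1 0 = 0 ∧ g.det ≠ 0}

/-- membership of t ∈ T(F) = (Talg a b c)ˣ in U_m: U_0 = T(F) ∩ GL₂(𝔬), and for m ≥ 1,
U_m = { t ∈ T(F) : t − 1 ∈ ϖ^m·M₂(𝔬) } -/
def UmemU (v : Valuation F Zm0) (a b c : F) (m : ℕ) (t : (Talg a b c)ˣ) : Prop :=
  if m = 0 then
    (∀ i j, v (((t : Talg a b c) : Matrix (Fin 2) (Fin 2) F) i j) ≤ ev 0)
      ∧ v (((t : Talg a b c) : Matrix (Fin 2) (Fin 2) F)).det = ev 0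
  else ∀ i j, v ((((t : Talg a b c) : Matrix (Fin 2) (Fin 2) F) - 1) i j) ≤ ev m

/-- the defining property of the function f̂ of Lemma "non-vanishing-int-lemma":
supported on B(F)·K₂(𝔭^r), with value |α/δ|^{1/2} χ₁(α) χ₂(δ) at [[α,β'],[0,δ]]·k. -/
def NewformProp (v : Valuation F Zm0) (absF : F → ℝ) (χ₁ χ₂ : F → ℂ) (r : ℕ)
    (fhat : Matrix (Fin 2) (Fin 2) F → ℂ) : Prop :=
  (∀ (g : Matrix (Fin 2) (Fin 2) F) (α δ β' : F) (k : Matrix (Fin 2) (Fin 2) F),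
    α ≠ 0 → δ ≠ 0 → k ∈ K2 v r → g = !![α, β'; 0, δ] * k →
    fhat g = (Real.sqrt (absF (α / δ)) : ℂ) * χ₁ α * χ₂ δ)
  ∧ (∀ g, g ∉ BF F * K2 v r → fhat g = 0)

lemma ev_zero' : ev 0 = 1 := by simp [ev]

lemma ev_mul (m n : ℤ) : ev m * ev n = ev (m + n) := by
  simp only [ev, ← WithZero.coe_mul, ← ofAdd_add]
  congr 2; ring

lemma ev_ne_zero (m : ℤ) : ev m ≠ 0 := by simp [ev]

lemma ev_le (m n : ℤ) : ev m ≤ ev n ↔ n ≤ m := by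
  rw [ev, ev, WithZero.coe_le_coe, Multiplicative.ofAdd_le, neg_le_neg_iff]

lemma ev_lt (m n : ℤ) : ev m < ev n ↔ n < m := by
  rw [ev, ev, WithZero.coe_lt_coe, Multiplicative.ofAdd_lt, neg_lt_neg_iff]

lemma exists_ev (x : Zm0) (hx : x ≠ 0) : ∃ k, x = ev k := by
  obtain ⟨y, rfl⟩ := WithZero.ne_zero_iff_exists.mp hx
  exact ⟨-(Multiplicative.toAdd y), by simp [ev]⟩

lemma v_unit_of (v : Valuation F Zm0) (u : F) (n : ℕ) (hn : 1 ≤ n) (h : v (u - 1) ≤ ev n) :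
    v u = 1 := by
  have : v (u - 1) < v 1 := by
    rw [map_one, ← ev_zero']
    refine lt_of_le_of_lt h ?_
    rw [ev_lt]; omega
  simpa using Valuation.map_eq_of_sub_lt v this

lemma K2_facts (v : Valuation F Zm0) (n : ℕ) (hn : 1 ≤ n) (k : Matrix (Fin 2) (Fin 2) F)
    (hk : k ∈ K2 v n) : v (k 1 1) = 1 ∧ v (k.det / k 1 1 - 1) ≤ ev n ∧ v (k.det / k 1 1) = 1 := by
  obtain ⟨⟨hi, hd⟩, h00, h11, h10⟩ := hk
  have h1 := v_unit_of v _ n hn h11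
  have hne : k 1 1 ≠ 0 := by
    intro h; rw [h] at h1; simp at h1
  refine ⟨h1, ?_, by rw [map_div₀, hd, h1, ev_zero', div_one]⟩
  have : k.det / k 1 1 - 1 = (k 0 0 - 1) - k 0 1 * k 1 0 / k 1 1 := by
    rw [Matrix.det_fin_two]; field_simp; ring
  rw [this]
  refine (Valuation.map_sub v _ _).trans (max_le h00 ?_)
  rw [map_div₀, h1, div_one, map_mul]
  have := hi 0 1
  rw [ev_zero'] at this
  exact (mul_le_of_le_one_left' this).trans h10

lemma decomp (v : Valuation F Zm0) (n : ℕ) (g : Matrix (Fin 2) (Fin 2) F)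
    (hw : g 1 1 ≠ 0) (h : v (g 1 0) ≤ v (g 1 1) * ev n) :
    !![1, 0; g 1 0 / g 1 1, 1] ∈ K2 v n ∧
    g = !![g.det / g 1 1, g 0 1; 0, g 1 1] * !![1, 0; g 1 0 / g 1 1, 1] := by
  have hs : v (g 1 0 / g 1 1) ≤ ev n := by
    rw [map_div₀]
    have h0 : v (g 1 1) ≠ 0 := by simpa using hw
    exact (div_le_iff₀ (zero_lt_iff.mpr h0)).mpr (by rwa [mul_comm])
  have hs0 : v (g 1 0 / g 1 1) ≤ 1 := hs.trans (by rw [← ev_zero', ev_le]; omega)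
  constructor
  · refine ⟨⟨?_, ?_⟩, ?_, ?_, ?_⟩
    · intro i j
      fin_cases i <;> fin_cases j <;> simp [ev_zero'] 
      simpa using hs0
    · simp [Matrix.det_fin_two, ev_zero']
    · simp
    · simp
    · simpa using hs
  · ext i j
    fin_cases i <;> fin_cases j <;> simp [Matrix.mul_apply, Fin.sum_univ_two, Matrix.det_fin_two]
      <;> field_simp
    ring

lemma mem_BK (v : Valuation F Zm0) (n : ℕ) (hn : 1 ≤ n) (g : Matrix (Fin 2) (Fin 2) F) :
    g ∈ BF F * K2 v n ↔ g.det ≠ 0 ∧ g 1 1 ≠ 0 ∧ v (g 1 0) ≤ v (g 1 1) * ev n := by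
  constructor
  · rintro ⟨β, ⟨hβ, hβd⟩, k, hk, rfl⟩
    obtain ⟨h1, -, h2⟩ := K2_facts v n hn k hk
    have hk1 : k 1 1 ≠ 0 := by intro h; rw [h] at h1; simp at h1
    have hkd : k.det ≠ 0 := by intro h; rw [h] at h2; simp at h2
    have hb1 : β 1 1 ≠ 0 := by
      intro h; apply hβd; rw [Matrix.det_fin_two, hβ, h]; simp
    refine ⟨?_, ?_, ?_⟩
    · simp only [Matrix.det_mul]; exact mul_ne_zero hβd hkd
    · simp [Matrix.mul_apply, Fin.sum_univ_two, hβ, hb1, hk1]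
    · simp only [Matrix.mul_apply, Fin.sum_univ_two, hβ, zero_mul, zero_add, map_mul, h1, mul_one]
      exact mul_le_mul_right hk.2.2.2 _
  · rintro ⟨hd, hw, h⟩
    obtain ⟨hk, he⟩ := decomp v n g hw h
    refine ⟨_, ⟨?_, ?_⟩, _, hk, he.symm⟩
    · simp
    · rw [Matrix.det_fin_two_of]
      simpa [hw] using hd

/-- explicit formula -/
def fval (absF : F → ℝ) (χ₁ χ₂ : F → ℂ) (g : Matrix (Fin 2) (Fin 2) F) : ℂ :=
  (Real.sqrt (absF (g.det / g 1 1 / g 1 1)) : ℂ) * χ₁ (g.det / g 1 1) * χ₂ (g 1 1)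

lemma newform_val (v : Valuation F Zm0) (absF : F → ℝ) (χ₁ χ₂ : F → ℂ) (n : ℕ)
    (f : Matrix (Fin 2) (Fin 2) F → ℂ) (hf : NewformProp v absF χ₁ χ₂ n f)
    (g : Matrix (Fin 2) (Fin 2) F) (hd : g.det ≠ 0)
    (hw : g 1 1 ≠ 0) (h : v (g 1 0) ≤ v (g 1 1) * ev n) : f g = fval absF χ₁ χ₂ g := by
  obtain ⟨hk, he⟩ := decomp v n g hw h
  exact hf.1 g _ _ _ _ (div_ne_zero hd hw) hw hk he

lemma newform_exists (v : Valuation F Zm0) (q : ℕ) (absF : F → ℝ)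
    (habs : ∀ (x : F) (k : ℤ), v x = ev k → absF x = (q : ℝ) ^ (-k)) (χ₁ χ₂ : F → ℂ)
    (hχ₁mul : ∀ x y : F, x ≠ 0 → y ≠ 0 → χ₁ (x * y) = χ₁ x * χ₁ y)
    (hχ₂mul : ∀ x y : F, x ≠ 0 → y ≠ 0 → χ₂ (x * y) = χ₂ x * χ₂ y)
    (n : ℕ) (hn : 1 ≤ n)
    (h1 : ∀ u : F, v u = ev (0 : ℤ) → v (u - 1) ≤ ev n → χ₁ u = 1)
    (h2 : ∀ u : F, v u = ev (0 : ℤ) → v (u - 1) ≤ ev n → χ₂ u = 1) :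
    ∃! f, NewformProp v absF χ₁ χ₂ n f := by
  classical
  refine ⟨fun g => if g ∈ BF F * K2 v n then fval absF χ₁ χ₂ g else 0, ⟨?_, ?_⟩, ?_⟩
  · rintro g α δ β' k hα hδ hk rfl
    have hm : !![α, β'; 0, δ] * k ∈ BF F * K2 v n :=
      ⟨_, ⟨by simp, by simp [Matrix.det_fin_two, hα, hδ]⟩, k, hk, rfl⟩
    simp only [hm, if_true]
    obtain ⟨e1, e2, e3⟩ := K2_facts v n hn k hk
    have hk1 : k 1 1 ≠ 0 := by intro h; rw [h] at e1; simp at e1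
    have hkd : k.det / k 1 1 ≠ 0 := by intro h; rw [h] at e3; simp at e3
    have w : (!![α, β'; 0, δ] * k) 1 1 = δ * k 1 1 := by
      simp [Matrix.mul_apply, Fin.sum_univ_two]
    have dd : (!![α, β'; 0, δ] * k).det / (δ * k 1 1) = α * (k.det / k 1 1) := by
      rw [Matrix.det_mul, Matrix.det_fin_two]; simp; field_simp
    have hv : v (α * (k.det / k 1 1) / (δ * k 1 1)) = v (α / δ) := by
      simp only [map_mul, map_div₀] at e3 ⊢
      rw [e3, e1, mul_one, mul_one]
    have ha : absF (α * (k.det / k 1 1) / (δ * k 1 1)) = absF (α / δ) := by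
      obtain ⟨m, hm⟩ := exists_ev (v (α / δ)) (by simp [hα, hδ])
      rw [habs _ m hm, habs _ m (hv.trans hm)]
    rw [fval, w, dd, ha, hχ₁mul _ _ hα hkd, hχ₂mul _ _ hδ hk1,
      h1 _ (by rw [e3, ev_zero']) e2, h2 _ (by rw [e1, ev_zero']) hk.2.2.1]
    ring
  · intro g hg
    simp [hg]
  · intro f hf
    funext g
    by_cases hg : g ∈ BF F * K2 v n
    · simp only [hg, if_true]
      obtain ⟨a1, a2, a3⟩ := (mem_BK v n hn g).1 hg
      exact newform_val v absF χ₁ χ₂ n f hf g a1 a2 a3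
    · simp only [hg, if_false]
      exact hf.2 g hg

lemma compact_int [Valued F Zm0] [CompleteSpace F]
    (ϖ : F) (hϖ : Valued.v ϖ = ev 1)
    (hq : ∃ R : Finset F, (∀ r ∈ R, Valued.v r ≤ ev (0 : ℤ)) ∧
      ∀ x : F, Valued.v x ≤ ev (0 : ℤ) → ∃ r, r ∈ R ∧ Valued.v (x - r) ≤ ev (1 : ℤ)) :
    IsCompact {x : F | Valued.v x ≤ 1} := by
  classical
  have hcl : IsClosed {x : F | Valued.v x ≤ 1} := Valued.isClosed_integer F
  rw [isCompact_iff_totallyBounded_isComplete]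
  refine ⟨?_, hcl.isComplete⟩
  obtain ⟨R, hR, hR'⟩ := hq
  have hϖ0 : ϖ ≠ 0 := by
    intro h; rw [h] at hϖ; simp [ev] at hϖ
  have hpow : ∀ n : ℕ, Valued.v (ϖ ^ n) = ev n := by
    intro n
    induction n with
    | zero => simp [ev_zero']
    | succ n ih => rw [pow_succ, map_mul, ih, hϖ, ev_mul]; simp
  have key : ∀ n : ℕ, ∃ S : Finset F, ∀ x : F, Valued.v x ≤ 1 → ∃ s ∈ S, Valued.v (x - s) ≤ ev n := by
    intro n
    induction n with
    | zero => exact ⟨{0}, fun x hx => ⟨0, by simp, by simpa [ev_zero'] using hx⟩⟩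
    | succ n ih =>
      obtain ⟨S, hS⟩ := ih
      refine ⟨Finset.image₂ (fun s r => s + ϖ ^ n * r) S R, fun x hx => ?_⟩
      obtain ⟨s, hs, hxs⟩ := hS x hx
      have hne : ϖ ^ n ≠ 0 := pow_ne_zero _ hϖ0
      have : Valued.v ((x - s) / ϖ ^ n) ≤ ev 0 := by
        rw [map_div₀, hpow, ev_zero']
        exact (div_le_one₀ (zero_lt_iff.mpr (ev_ne_zero _))).mpr hxs
      obtain ⟨r, hr, hxr⟩ := hR' _ this
      refine ⟨_, Finset.mem_image₂_of_mem hs hr, ?_⟩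
      have e : x - (s + ϖ ^ n * r) = ϖ ^ n * ((x - s) / ϖ ^ n - r) := by
        field_simp; ring
      rw [e, map_mul, hpow]
      calc ev n * _ ≤ ev n * ev 1 := mul_le_mul_right hxr _
        _ = _ := by rw [ev_mul]; simp
  rw [(Valued.hasBasis_uniformity F Zm0).totallyBounded_iff]
  intro γ _
  have hγ : MonoidWithZeroHom.ValueGroup₀.embedding (γ : MonoidWithZeroHom.ValueGroup₀ (.ofClass (Valued.v : Valuation F Zm0))) ≠ 0 := by
    simp
  obtain ⟨k, hk⟩ := exists_ev _ hγ
  obtain ⟨S, hS⟩ := key (k.toNat + 1)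
  refine ⟨S, S.finite_toSet, fun x hx => ?_⟩
  obtain ⟨s, hs, hxs⟩ := hS x hx
  refine Set.mem_iUnion₂.mpr ⟨s, hs, ?_⟩
  change Valued.v.restrict (s - x) < _
  rw [Valuation.restrict_lt_iff_lt_embedding, hk, Valuation.map_sub_swap]
  refine lt_of_le_of_lt hxs ?_
  rw [ev_lt]
  push_cast
  omega

lemma clopen_aux {X : Type*} [TopologicalSpace X] [Valued F Zm0]
    (ϖ : F) (hϖ : Valued.v ϖ = ev 1) (n : ℕ) (p w : X → F) (hp : Continuous p)
    (hw : Continuous w) (h0 : ∀ x, p x ≠ 0 ∨ w x ≠ 0) :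
    IsClopen {x | w x ≠ 0 ∧ Valued.v (p x) ≤ Valued.v (w x) * ev n} := by
  have hϖ0 : ϖ ≠ 0 := by
    intro h; rw [h] at hϖ; simp [ev] at hϖ
  have hpow : Valued.v (ϖ ^ n) = ev n := by
    clear hp hw h0
    induction n with
    | zero => simp [ev_zero']
    | succ n ih => rw [pow_succ, map_mul, ih, hϖ, ev_mul]; simp
  have hne : ϖ ^ n ≠ 0 := pow_ne_zero _ hϖ0
  have hopen1 : IsOpen {x : F | Valued.v x ≤ 1} := Valued.isOpen_integer F
  have hopen2 : IsOpen {x : F | Valued.v x < 1} := by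
    have := Valued.isOpen_ball F 1
    simpa only [Valuation.restrict_lt_one_iff] using this
  have hw0 : IsOpen {x | w x ≠ 0} := isOpen_ne_fun hw continuous_const
  have hp0 : IsOpen {x | p x ≠ 0} := isOpen_ne_fun hp continuous_const
  constructor
  · rw [← isOpen_compl_iff]
    have hc : ContinuousOn (fun x => w x * ϖ ^ n / p x) {x | p x ≠ 0} :=
      ContinuousOn.div (by fun_prop) (by fun_prop) (fun x hx => hx)
    convert hc.isOpen_inter_preimage hp0 hopen2 using 1
    ext x
    simp only [Set.mem_compl_iff, Set.mem_ofPred_eq, not_and, not_le, Set.mem_inter_iff,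
      Set.mem_preimage, map_div₀, map_mul, hpow]
    by_cases hpx : p x = 0
    · have := (h0 x).resolve_left (by simpa using hpx)
      simp [hpx, this]
    · have : 0 < Valued.v (p x) := zero_lt_iff.mpr (by simpa using hpx)
      rw [div_lt_one₀ this]
      by_cases hwx : w x = 0
      · simpa [hwx, hpx] using this
      · simp [hwx, hpx]
  · have hc : ContinuousOn (fun x => p x / (w x * ϖ ^ n)) {x | w x ≠ 0} :=
      ContinuousOn.div (by fun_prop) (by fun_prop) (fun x hx => mul_ne_zero hx hne)
    convert hc.isOpen_inter_preimage hw0 hopen1 using 1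
    ext x
    simp only [Set.mem_ofPred_eq, Set.mem_inter_iff,
      Set.mem_preimage, map_div₀, map_mul, hpow]
    refine and_congr_right fun hwx => ?_
    rw [div_le_one₀]
    exact zero_lt_iff.mpr (mul_ne_zero (by simpa using hwx) (ev_ne_zero _))

/-- underlying matrix of a torus element -/
abbrev matT {a b c : F} (t : (Talg a b c)ˣ) : Matrix (Fin 2) (Fin 2) F :=
  ((t : Talg a b c) : Matrix (Fin 2) (Fin 2) F)

lemma N_ne (a b c : F) (hnonsq : ∀ s : F, s ^ 2 ≠ b ^ 2 - 4 * (a * c)) (x y : F)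
    (h : x ≠ 0 ∨ y ≠ 0) : x ^ 2 - b * x * y + a * c * y ^ 2 ≠ 0 := by
  intro hN
  by_cases hy : y = 0
  · subst hy
    simp at hN h
    exact h hN
  · apply hnonsq ((2 * x - b * y) / y)
    field_simp
    linear_combination 4 * hN

/-- the torus element t(x,y) -/
def mkT (a b c x y : F) (h : x ^ 2 - b * x * y + a * c * y ^ 2 ≠ 0) : (Talg a b c)ˣ where
  val := ⟨x • (1 : Matrix (Fin 2) (Fin 2) F) + y • Mmat a b c, x, y, rfl⟩
  inv := ⟨((x ^ 2 - b * x * y + a * c * y ^ 2)⁻¹ * (x - b * y)) • (1 : Matrix (Fin 2) (Fin 2) F)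
    + (-((x ^ 2 - b * x * y + a * c * y ^ 2)⁻¹ * y)) • Mmat a b c, _, _, rfl⟩
  val_inv := by
    have e := inv_mul_cancel₀ h
    generalize (x ^ 2 - b * x * y + a * c * y ^ 2)⁻¹ = i at e ⊢
    apply Subtype.ext
    ext i j
    fin_cases i <;> fin_cases j <;>
    · simp [Mmat, Matrix.mul_apply, Fin.sum_univ_two]
      first | ring1 | linear_combination e
  inv_val := by
    have e := inv_mul_cancel₀ h
    generalize (x ^ 2 - b * x * y + a * c * y ^ 2)⁻¹ = i at e ⊢
    apply Subtype.ext
    ext i j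
    fin_cases i <;> fin_cases j <;>
    · simp [Mmat, Matrix.mul_apply, Fin.sum_univ_two]
      first | ring1 | linear_combination e

lemma matT_mkT (a b c x y : F) (h : x ^ 2 - b * x * y + a * c * y ^ 2 ≠ 0) :
    matT (mkT a b c x y h) = x • (1 : Matrix (Fin 2) (Fin 2) F) + y • Mmat a b c := rfl

lemma matT_coords {a b c : F} (t : (Talg a b c)ˣ) :
    ∃ x y : F, matT t = x • (1 : Matrix (Fin 2) (Fin 2) F) + y • Mmat a b c := (t : Talg a b c).2

lemma matT_det_ne {a b c : F} (t : (Talg a b c)ˣ) : (matT t).det ≠ 0 := by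
  have h : matT t * matT t⁻¹ = 1 := by
    exact congrArg (Subtype.val) (t.mul_inv)
  intro h0
  have := congrArg Matrix.det h
  rw [Matrix.det_mul, h0] at this
  simp at this

lemma coords_det (a b c x y : F) :
    (x • (1 : Matrix (Fin 2) (Fin 2) F) + y • Mmat a b c).det
      = x ^ 2 - b * x * y + a * c * y ^ 2 := by
  rw [Matrix.det_fin_two]; simp [Mmat]; ring

lemma coords_10 (a b c x y : F) :
    (x • (1 : Matrix (Fin 2) (Fin 2) F) + y • Mmat a b c) 1 0 = -(a * y) := by
  simp [Mmat]; ring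

lemma coords_11 (a b c x y : F) :
    (x • (1 : Matrix (Fin 2) (Fin 2) F) + y • Mmat a b c) 1 1 = x - b * y := by
  simp [Mmat]; ring

/-- central element -/
abbrev zT (a b c : F) (z : Fˣ) : (Talg a b c)ˣ :=
  Units.map (algebraMap F (Talg a b c)).toMonoidHom z

lemma matT_zT_mul (a b c : F) (z : Fˣ) (t : (Talg a b c)ˣ) :
    matT (zT a b c z * t) = (z : F) • matT t := by
  simp [matT, Matrix.algebraMap_eq_diagonal, Matrix.smul_eq_diagonal_mul]
  rfl

lemma eq_zT_mul (a b c : F) (z : Fˣ) (t t' : (Talg a b c)ˣ) (h : matT t' = (z : F) • matT t) :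
    t' = zT a b c z * t := by
  apply Units.ext
  apply Subtype.ext
  exact h.trans (matT_zT_mul a b c z t).symm

lemma mk_zT_mul (a b c : F) (z : Fˣ) (t : (Talg a b c)ˣ) :
    (QuotientGroup.mk (zT a b c z * t) : (Talg a b c)ˣ ⧸ Zsub a b c) = QuotientGroup.mk t := by
  rw [QuotientGroup.mk_mul]
  have : (QuotientGroup.mk (zT a b c z) : (Talg a b c)ˣ ⧸ Zsub a b c) = 1 :=
    (QuotientGroup.eq_one_iff _).2 ⟨z, rfl⟩
  rw [this, one_mul]

lemma compact_quot [Valued F Zm0] [CompleteSpace F] (a b c : F)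
    (hnonsq : ∀ s : F, s ^ 2 ≠ b ^ 2 - 4 * (a * c))
    (hK : IsCompact {x : F | Valued.v x ≤ 1}) :
    CompactSpace ((Talg a b c)ˣ ⧸ Zsub a b c) := by
  let f1 : F → (Talg a b c)ˣ := fun x => mkT a b c x 1 (N_ne a b c hnonsq x 1 (by simp))
  let f2 : F → (Talg a b c)ˣ := fun y => mkT a b c 1 y (N_ne a b c hnonsq 1 y (by simp))
  have c1 : Continuous f1 := by
    rw [Units.continuous_iff]
    constructor
    · exact Continuous.subtype_mk (by fun_prop) _
    · refine Continuous.subtype_mk ?_ _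
      have : Continuous fun x : F => (x ^ 2 - b * x * 1 + a * c * 1 ^ 2)⁻¹ :=
        Continuous.inv₀ (by fun_prop) (fun x => N_ne a b c hnonsq x 1 (by simp))
      fun_prop
  have c2 : Continuous f2 := by
    rw [Units.continuous_iff]
    constructor
    · exact Continuous.subtype_mk (by fun_prop) _
    · refine Continuous.subtype_mk ?_ _
      have : Continuous fun y : F => (1 ^ 2 - b * 1 * y + a * c * y ^ 2)⁻¹ :=
        Continuous.inv₀ (by fun_prop) (fun x => N_ne a b c hnonsq 1 x (by simp))
      fun_prop
  let π : (Talg a b c)ˣ → (Talg a b c)ˣ ⧸ Zsub a b c := QuotientGroup.mk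
  have cπ : Continuous π := continuous_quot_mk
  have k1 := hK.image (cπ.comp c1)
  have k2 := hK.image (cπ.comp c2)
  constructor
  convert k1.union k2
  symm
  rw [Set.eq_univ_iff_forall]
  intro Q
  obtain ⟨t, rfl⟩ := QuotientGroup.mk_surjective Q
  obtain ⟨x, y, hxy⟩ := matT_coords t
  have hdet := matT_det_ne t
  rw [hxy, coords_det] at hdet
  by_cases h : Valued.v x ≤ Valued.v y
  · left
    have hy : y ≠ 0 := by
      rintro rfl
      simp at h
      simp [h] at hdet
    refine ⟨x / y, ?_, ?_⟩
    · simp only [Set.mem_ofPred_eq, map_div₀]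
      exact (div_le_one₀ (zero_lt_iff.mpr (by simpa using hy))).mpr h
    · have : t = zT a b c (Units.mk0 y hy) * f1 (x / y) := by
        apply eq_zT_mul
        rw [hxy, matT_mkT, smul_add, smul_smul, smul_smul]
        simp only [Units.val_mk0, mul_one]
        rw [mul_div_cancel₀ _ hy]
      rw [this, mk_zT_mul]
      rfl
  · right
    push Not at h
    have hx : x ≠ 0 := by
      rintro rfl
      simp at h
    refine ⟨y / x, ?_, ?_⟩
    · simp only [Set.mem_ofPred_eq, map_div₀]
      exact (div_le_one₀ (zero_lt_iff.mpr (by simpa using hx))).mpr h.le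
    · have : t = zT a b c (Units.mk0 x hx) * f2 (y / x) := by
        apply eq_zT_mul
        rw [hxy, matT_mkT, smul_add, smul_smul, smul_smul]
        simp only [Units.val_mk0, mul_one]
        rw [mul_div_cancel₀ _ hx]
      rw [this, mk_zT_mul]
      rfl

/-- existence and uniqueness of f̂, and for any such f̂ the function
t ↦ f̂(t)·Ω(t)⁻¹ descends to a locally constant function on the compact quotient group
T(F)/Z_T whose integral against any Haar measure is nonzero. -/
theorem stmt5 [CharZero F] [Valued F Zm0] [CompleteSpace F]
    (ϖ : F) (hϖ : Valued.v ϖ = ev 1)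
    (a b c : F)
    (hao : Valued.v a ≤ ev (0 : ℤ)) (hbo : Valued.v b ≤ ev (0 : ℤ))
    (hc : Valued.v c = ev (0 : ℤ))
    (hd0 : b ^ 2 - 4 * (a * c) ≠ 0)
    (hnonsq : ∀ s : F, s ^ 2 ≠ b ^ 2 - 4 * (a * c))
    -- q is the cardinality of the residue field 𝔬/𝔭 :
    (q : ℕ) (hq : ∃ R : Finset F, R.card = q ∧ (∀ r ∈ R, Valued.v r ≤ ev (0 : ℤ)) ∧
      ∀ x : F, Valued.v x ≤ ev (0 : ℤ) → ∃! r, r ∈ R ∧ Valued.v (x - r) ≤ ev (1 : ℤ))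
    -- v(a) = va ≥ 0 :
    (va : ℕ) (hva : Valued.v a = ev va)
    -- the normalized absolute value, |x| = q^{−v(x)} :
    (absF : F → ℝ) (habs : ∀ (x : F) (k : ℤ), Valued.v x = ev k → absF x = (q : ℝ) ^ (-k))
    -- χ₁, χ₂ : F^× → ℂ^× homomorphisms with conductor exponents n₁, n₂ :
    (χ₁ χ₂ : F → ℂ)
    (hχ₁mul : ∀ x y : F, x ≠ 0 → y ≠ 0 → χ₁ (x * y) = χ₁ x * χ₁ y)
    (hχ₁ne : ∀ x : F, x ≠ 0 → χ₁ x ≠ 0)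
    (hχ₂mul : ∀ x y : F, x ≠ 0 → y ≠ 0 → χ₂ (x * y) = χ₂ x * χ₂ y)
    (hχ₂ne : ∀ x : F, x ≠ 0 → χ₂ x ≠ 0)
    (n₁ n₂ : ℕ)
    (hχ₁cond : ∀ u : F, Valued.v u = ev (0 : ℤ) → Valued.v (u - 1) ≤ ev n₁ → χ₁ u = 1)
    (hχ₁least : ∀ m : ℕ, m < n₁ →
      ∃ u : F, Valued.v u = ev (0 : ℤ) ∧ Valued.v (u - 1) ≤ ev m ∧ χ₁ u ≠ 1)
    (hχ₂cond : ∀ u : F, Valued.v u = ev (0 : ℤ) → Valued.v (u - 1) ≤ ev n₂ → χ₂ u = 1)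
    (hχ₂least : ∀ m : ℕ, m < n₂ →
      ∃ u : F, Valued.v u = ev (0 : ℤ) ∧ Valued.v (u - 1) ≤ ev m ∧ χ₂ u ≠ 1)
    -- Ω : T(F) → ℂ^× a homomorphism with conductor exponent C, Ω(z·1) = χ₁(z)χ₂(z) :
    (Ω : (Talg a b c)ˣ →* ℂˣ)
    (C : ℕ)
    (hΩcond : ∀ t : (Talg a b c)ˣ, UmemU Valued.v a b c C t → Ω t = 1)
    (hΩleast : ∀ m : ℕ, m < C → ∃ t : (Talg a b c)ˣ, UmemU Valued.v a b c m t ∧ Ω t ≠ 1)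
    (hcent : ∀ z : Fˣ,
      ((Ω (Units.map (algebraMap F (Talg a b c)).toMonoidHom z) : ℂˣ) : ℂ)
        = χ₁ (z : F) * χ₂ (z : F))
    -- r = max{c(Ω), c(χ₁) + c(χ₂)} + 1 + v(a) :
    (r : ℕ) (hr : r = max C (n₁ + n₂) + 1 + va)
    [MeasurableSpace ((Talg a b c)ˣ ⧸ Zsub a b c)]
    [BorelSpace ((Talg a b c)ˣ ⧸ Zsub a b c)] :
    -- f̂ exists and is unique :
    (∃! fhat : Matrix (Fin 2) (Fin 2) F → ℂ,
      NewformProp (Valued.v : Valuation F Zm0) absF χ₁ χ₂ r fhat)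
    -- the quotient group T(F)/Z_T is compact :
    ∧ CompactSpace ((Talg a b c)ˣ ⧸ Zsub a b c)
    -- and for any such f̂, t ↦ f̂(t)Ω(t)⁻¹ descends to a locally constant function on
    -- T(F)/Z_T with nonzero integral against any Haar measure :
    ∧ ∀ fhat : Matrix (Fin 2) (Fin 2) F → ℂ,
        NewformProp (Valued.v : Valuation F Zm0) absF χ₁ χ₂ r fhat →
        ∃ fbar : ((Talg a b c)ˣ ⧸ Zsub a b c) → ℂ,
          (∀ t : (Talg a b c)ˣ, fbar (QuotientGroup.mk t)
            = fhat (((t : Talg a b c) : Matrix (Fin 2) (Fin 2) F)) * (((Ω t)⁻¹ : ℂˣ) : ℂ))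
          ∧ IsLocallyConstant fbar
          ∧ ∀ μ : Measure ((Talg a b c)ˣ ⧸ Zsub a b c),
              μ.IsHaarMeasure → (∫ x, fbar x ∂μ) ≠ 0 := by
  classical
  have hr1 : 1 ≤ r := by omega
  have hK : IsCompact {x : F | Valued.v x ≤ 1} := by
    obtain ⟨R, -, h1, h2⟩ := hq
    exact compact_int ϖ hϖ ⟨R, h1, fun x hx => (h2 x hx).exists⟩
  have hcomp := compact_quot a b c hnonsq hK
  refine ⟨?_, hcomp, ?_⟩
  · refine newform_exists Valued.v q absF habs χ₁ χ₂ hχ₁mul hχ₂mul r hr1 ?_ ?_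
    · intro u h1 h2
      exact hχ₁cond u h1 (h2.trans ((ev_le _ _).2 (by omega)))
    · intro u h1 h2
      exact hχ₂cond u h1 (h2.trans ((ev_le _ _).2 (by omega)))
  intro fhat hf
  let S : Set (Talg a b c)ˣ :=
    {t | matT t 1 1 ≠ 0 ∧ Valued.v (matT t 1 0) ≤ Valued.v (matT t 1 1) * ev r}
  have hScl : IsClopen S := by
    have hm : Continuous (fun t : (Talg a b c)ˣ => matT t) :=
      continuous_subtype_val.comp Units.continuous_val
    refine clopen_aux ϖ hϖ r (fun t => matT t 1 0) (fun t => matT t 1 1)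
      (hm.matrix_elem 1 0) (hm.matrix_elem 1 1) ?_
    intro t
    by_contra h
    push Not at h
    apply matT_det_ne t
    rw [Matrix.det_fin_two, h.1, h.2]; simp
  have hSz : ∀ (z : Fˣ) (t : (Talg a b c)ˣ), t ∈ S → zT a b c z * t ∈ S := by
    rintro z t ⟨h1, h2⟩
    refine ⟨?_, ?_⟩
    · rw [matT_zT_mul]
      simpa using h1
    · rw [matT_zT_mul]
      simp only [Matrix.smul_apply, smul_eq_mul, map_mul, mul_assoc]
      exact mul_le_mul_right h2 _
  let π : (Talg a b c)ˣ → (Talg a b c)ˣ ⧸ Zsub a b c := QuotientGroup.mk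
  have hπS : π ⁻¹' (π '' S) = S := by
    ext t
    constructor
    · rintro ⟨t', ht', he⟩
      obtain ⟨z, hz⟩ := QuotientGroup.eq.1 he
      have : t = zT a b c z * t' := by
        have h1 : t = t' * zT a b c z := by
          rw [show zT a b c z = t'⁻¹ * t from hz]; group
        rw [h1]
        apply Units.ext
        exact (Algebra.commutes (z : F) (t' : Talg a b c)).symm
      rw [this]
      exact hSz z t' ht'
    · intro h
      exact ⟨t, h, rfl⟩
  have hqm : Topology.IsQuotientMap π := isQuotientMap_quot_mk
  have hQ : IsClopen (π '' S) := by
    rw [← hqm.isClopen_preimage, hπS]; exact hScl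
  have hval : ∀ t ∈ S, fhat (matT t) * (((Ω t)⁻¹ : ℂˣ) : ℂ) = 1 := by
    rintro t ⟨h1, h2⟩
    rw [newform_val _ absF χ₁ χ₂ r fhat hf (matT t) (matT_det_ne t) h1 h2]
    obtain ⟨x, y, hxy⟩ := matT_coords t
    rw [hxy, coords_11] at h1
    rw [hxy, coords_11, coords_10, Valuation.map_neg, map_mul, hva] at h2
    set w := x - b * y with hw
    obtain ⟨m, hm⟩ : ∃ m : ℕ, m = max C (n₁ + n₂) + 1 := ⟨_, rfl⟩
    have hs : Valued.v (y / w) ≤ ev m := by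
      rw [map_div₀, div_le_iff₀ (zero_lt_iff.mpr (by simpa using h1))]
      have e : ev (r : ℤ) = ev va * ev m := by
        rw [ev_mul]; congr 1; push_cast [hr, hm]; ring
      rw [e] at h2
      have h3 : ev va * Valued.v y ≤ ev va * (ev m * Valued.v w) := by
        refine h2.trans (le_of_eq ?_); rw [mul_comm, mul_assoc]
      exact (mul_le_mul_iff_right₀ (zero_lt_iff.mpr (ev_ne_zero _))).1 h3
    set s := y / w with hsdef
    have hy : y = w * s := by rw [hsdef]; field_simp
    have hx : x = w * (1 + b * s) := by
      have : x = w + b * y := by rw [hw]; ring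
      rw [this, hy]; ring
    have hmul : ∀ e : F, Valued.v e ≤ 1 → Valued.v (e * s) ≤ ev m := by
      intro e he
      rw [map_mul]
      exact (mul_le_of_le_one_left' he).trans hs
    rw [ev_zero'] at hao hbo hc
    have hs1 : Valued.v s ≤ 1 := hs.trans (by rw [← ev_zero', ev_le]; omega)
    set u := (1 + b * s) ^ 2 - b * (1 + b * s) * s + a * c * s ^ 2 with hu
    have hu1 : Valued.v (u - 1) ≤ ev m := by
      have : u - 1 = (b + a * c * s) * s := by rw [hu]; ring
      rw [this]
      apply hmul
      refine (Valuation.map_add _ _ _).trans (max_le hbo ?_)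
      rw [map_mul, map_mul, hc, mul_one]
      exact mul_le_one' hao hs1
    have huv : Valued.v u = 1 := v_unit_of _ u m (by omega) hu1
    have hu0 : u ≠ 0 := by intro h; rw [h] at huv; simp at huv
    let t' := mkT a b c (1 + b * s) s hu0
    have htt : t = zT a b c (Units.mk0 w h1) * t' := by
      apply eq_zT_mul
      rw [hxy, matT_mkT, smul_add, smul_smul, smul_smul, Units.val_mk0, ← hx, ← hy]
    have hΩ' : Ω t' = 1 := by
      apply hΩcond
      have hCm : ev m ≤ ev C := (ev_le _ _).2 (by omega)
      have hm1 : ev m ≤ 1 := by rw [← ev_zero', ev_le]; omega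
      have hent : ∀ i j, Valued.v ((matT t' - 1) i j) ≤ ev m := by
        intro i j
        rw [matT_mkT]
        fin_cases i <;> fin_cases j
        · simpa [Mmat] using hmul b hbo
        · simpa [Mmat, mul_comm] using hmul c hc.le
        · simpa [Mmat, mul_comm] using hmul a hao
        · have : (((1 + b * s) • (1 : Matrix (Fin 2) (Fin 2) F) + s • Mmat a b c) - 1) 1 1 = 0 := by
            simp [Mmat]; ring
          simp only [Fin.mk_one, this, map_zero, zero_le]
      unfold UmemU
      split_ifs with hC
      · refine ⟨fun i j => ?_, ?_⟩
        · have h3 : matT t' i j = (matT t' - 1) i j + (1 : Matrix (Fin 2) (Fin 2) F) i j := by simp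
          change Valued.v (matT t' i j) ≤ _
          rw [h3, ev_zero']
          refine (Valuation.map_add _ _ _).trans (max_le ((hent i j).trans hm1) ?_)
          fin_cases i <;> fin_cases j <;> simp
        · change Valued.v (matT t').det = _
          rw [matT_mkT, coords_det, ← hu, huv, ev_zero']
      · exact fun i j => (hent i j).trans hCm
    have hΩt : ((Ω t : ℂˣ) : ℂ) = χ₁ w * χ₂ w := by
      rw [htt, map_mul, hΩ', mul_one, hcent]
      rfl
    have hdet : (matT t).det = w * w * u := by
      rw [hxy, coords_det, hu, hx, hy]; ring
    have hw11 : matT t 1 1 = w := by rw [hxy, coords_11]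
    have e1 : w * w * u / w = w * u := by field_simp
    have e2 : w * u / w = u := by field_simp
    have hab : absF u = 1 := by
      rw [habs u 0 (by rw [huv, ev_zero'])]; simp
    have hχu : χ₁ u = 1 :=
      hχ₁cond u (by rw [huv, ev_zero']) (hu1.trans ((ev_le _ _).2 (by omega)))
    rw [fval, hdet, hw11, e1, e2, hab, hχ₁mul _ _ h1 hu0, hχu, Units.val_inv_eq_inv_val, hΩt]
    have := hχ₁ne w h1
    have := hχ₂ne w h1
    simp
    field_simp
  have hval0 : ∀ t ∉ S, fhat (matT t) * (((Ω t)⁻¹ : ℂˣ) : ℂ) = 0 := by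
    intro t ht
    rw [hf.2, zero_mul]
    intro h
    exact ht ((mem_BK _ r hr1 _).1 h).2
  refine ⟨(π '' S).indicator (fun _ => 1), ?_, ?_, ?_⟩
  · intro t
    have hiff : (QuotientGroup.mk t : (Talg a b c)ˣ ⧸ Zsub a b c) ∈ π '' S ↔ t ∈ S := by
      conv_rhs => rw [← hπS]
      rfl
    by_cases ht : t ∈ S
    · rw [Set.indicator_of_mem (hiff.2 ht)]
      exact (hval t ht).symm
    · rw [Set.indicator_of_notMem (fun h => ht (hiff.1 h))]
      exact (hval0 t ht).symm
  · exact (LocallyConstant.charFn ℂ hQ).isLocallyConstant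
  · intro μ hμ
    rw [integral_indicator_const _ hQ.isOpen.measurableSet]
    have hne : (π '' S).Nonempty := by
      refine ⟨π 1, 1, ⟨?_, ?_⟩, rfl⟩ <;> simp [matT]
    have hpos : μ (π '' S) ≠ 0 := hQ.isOpen.measure_ne_zero μ hne
    have hfin : μ (π '' S) ≠ ⊤ := (hQ.isClosed.isCompact.measure_lt_top).ne
    simp [Measure.real, ENNReal.toReal_eq_zero_iff, hpos, hfin]
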